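/- arXiv:2408.12147 — 3 statements merged into one kernel-verified Lean document; each statement's English description precedes it below -/
import Mathlib

section
/- Let X be a finite geodetic quasi metric space. Then the following are equivalent: (1) X is diagonal; (2) X is 2-diagonal; (3) there is no 4-cut in X. -/
open scoped ENNReal NNReal

attribute [local instance] Classical.propDecidable

/-- A quasi metric space: `d x y = 0 ↔ x = y` and the triangle inequality;
infinite values and non-symmetry are allowed. -/
structure QuasiMetric (X : Type) : Type where
  d : X → X → ℝ≥0∞
  d_eq_zero_iff : ∀ x y : X, d x y = 0 ↔ x = y
  triangle : ∀ x y z : X, d x z ≤ d x y + d y z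

namespace QuasiMetric

variable {X : Type} (q : QuasiMetric X)

/-- `q.Btw x y z` means `x ≤ y ≤ z`, i.e. `d x y + d y z = d x z`. -/
def Btw (x y z : X) : Prop := q.d x y + q.d y z = q.d x z

/-- A quasi metric space is geodetic if each interval `I(a,b)` (with `d a b < ∞`)
is totally ordered by `x ⪯ y ↔ a ≤ x ≤ y`. -/
def Geodetic : Prop :=
  ∀ a b x y : X, q.d a b ≠ ∞ → q.Btw a x b → q.Btw a y b →
    q.Btw a x y ∨ q.Btw a y x

/-- The length of a tuple `(x_0, …, x_n)`. -/
noncomputable def len {n : ℕ} (t : Fin (n + 1) → X) : ℝ≥0∞ :=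
  ∑ i : Fin n, q.d (t i.castSucc) (t i.succ)

end QuasiMetric

/-- The `n`-th magnitude chain group: the free abelian group on all `(n+1)`-tuples.
(The magnitude chain complex itself lives on the submodules spanned by tuples with
finite consecutive distances; see `QuasiMetric.grMC` below.) -/
abbrev MC (X : Type) (n : ℕ) : Type := (Fin (n + 1) → X) →₀ ℤ

namespace QuasiMetric

variable {X : Type} (q : QuasiMetric X)

/-- The condition under which the `i`-th entry of a tuple `(x_0, …, x_{n+1})` is deleted by
the boundary operator: `x_{i-1} ≤ x_i ≤ x_{i+1}` with the conventions `x_{-1} = x_1` and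
`x_{n+2} = x_n`. -/
def delCond {n : ℕ} (t : Fin (n + 2) → X) (i : Fin (n + 2)) : Prop :=
  q.Btw
    (if _ : (i : ℕ) = 0 then t ⟨1, by omega⟩
      else t ⟨(i : ℕ) - 1, by have := i.isLt; omega⟩)
    (t i)
    (if _ : (i : ℕ) = n + 1 then t ⟨n, by omega⟩
      else t ⟨(i : ℕ) + 1, by have := i.isLt; omega⟩)

/-- The boundary operator `∂ = Σ_i (-1)^i ∂_i` of the magnitude chain complex, where
`∂_i` deletes `x_i` when `x_{i-1} ≤ x_i ≤ x_{i+1}` (conventions `x_{-1} = x_1`,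
`x_{n+2} = x_n`) and is zero otherwise. -/
noncomputable def bdry (n : ℕ) : MC X (n + 1) →ₗ[ℤ] MC X n :=
  Finsupp.lift (MC X n) ℤ (Fin (n + 2) → X) fun t =>
    ∑ i : Fin (n + 2),
      if q.delCond t i then ((-1 : ℤ) ^ (i : ℕ)) • Finsupp.single (t ∘ i.succAbove) (1 : ℤ)
      else 0

/-- The degree `n`, length `ℓ` part of the magnitude chain complex: the span of the
tuples of length `ℓ`. (For `ℓ ≠ ∞` all consecutive distances of such tuples are finite.) -/
noncomputable def grMC (n : ℕ) (ℓ : ℝ≥0∞) : Submodule ℤ (MC X n) :=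
  Submodule.span ℤ {c | ∃ t : Fin (n + 1) → X, q.len t = ℓ ∧ c = Finsupp.single t 1}

/-- Cycles of the degree `n`, length `ℓ` part of the magnitude chain complex. -/
noncomputable def grZ (n : ℕ) (ℓ : ℝ≥0∞) : Submodule ℤ (MC X n) :=
  match n with
  | 0 => q.grMC 0 ℓ
  | (m + 1) => q.grMC (m + 1) ℓ ⊓ LinearMap.ker (q.bdry m)

/-- Boundaries of the degree `n`, length `ℓ` part of the magnitude chain complex. -/
noncomputable def grB (n : ℕ) (ℓ : ℝ≥0∞) : Submodule ℤ (MC X n) :=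
  Submodule.map (q.bdry n) (q.grMC (n + 1) ℓ)

/-- The magnitude homology `MH_n^ℓ(X)` : cycles modulo boundaries in the degree `n`,
length `ℓ` part of the magnitude chain complex. -/
abbrev grMH (n : ℕ) (ℓ : ℝ≥0∞) : Type :=
  ↥(q.grZ n ℓ) ⧸ Submodule.comap (q.grZ n ℓ).subtype (q.grB n ℓ)

end QuasiMetric

namespace QuasiMetric

variable {X : Type} (q : QuasiMetric X)

/-- A tuple is saturated if `x_i ≤ a ≤ x_{i+1}` implies `a = x_i` or `a = x_{i+1}`
for all consecutive indices. -/
def Saturated {n : ℕ} (t : Fin (n + 1) → X) : Prop :=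
  ∀ (i : Fin n) (a : X),
    q.Btw (t i.castSucc) a (t i.succ) → a = t i.castSucc ∨ a = t i.succ

/-- A quasi metric space is `n`-diagonal if every homology class in `MH_n^ℓ(X)` is
represented by a `ℤ`-linear combination of saturated tuples, for every `ℓ`. -/
def IsNDiagonal (n : ℕ) : Prop :=
  ∀ (ℓ : ℝ≥0) (z : q.grZ n (ℓ : ℝ≥0∞)),
    ∃ c : q.grZ n (ℓ : ℝ≥0∞),
      (c : MC X n) ∈ Submodule.span ℤ
          {f | ∃ t : Fin (n + 1) → X, q.len t = (ℓ : ℝ≥0∞) ∧ q.Saturated t ∧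
            f = Finsupp.single t 1} ∧
      (Submodule.Quotient.mk c : q.grMH n (ℓ : ℝ≥0∞)) = Submodule.Quotient.mk z

/-- A quasi metric space is diagonal if it is `n`-diagonal for every `n ≥ 0`. -/
def Diagonal : Prop := ∀ n : ℕ, q.IsNDiagonal n

/-- `(x0, x1, x2, x3)` is a 4-cut: consecutive distances are finite,
`x0 ≤ x1 ≤ x2`, `x1 ≤ x2 ≤ x3`, `x1 ≠ x2` and `¬(x0 ≤ x1 ≤ x3)`. -/
def FourCut (x0 x1 x2 x3 : X) : Prop :=
  q.d x0 x1 ≠ ∞ ∧ q.d x1 x2 ≠ ∞ ∧ q.d x2 x3 ≠ ∞ ∧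
  q.Btw x0 x1 x2 ∧ q.Btw x1 x2 x3 ∧ x1 ≠ x2 ∧ ¬ q.Btw x0 x1 x3

end QuasiMetric

namespace QuasiMetric

open Finsupp

variable {X : Type} (q : QuasiMetric X)

section Betweenness

variable {q}

lemma d_self (x : X) : q.d x x = 0 := (q.d_eq_zero_iff x x).2 rfl

lemma btw_left (x y : X) : q.Btw x x y := by simp [Btw, d_self]

lemma btw_right (x y : X) : q.Btw x y y := by simp [Btw, d_self]

lemma btw_self_iff {x y : X} : q.Btw x y x ↔ x = y := by
  constructor
  · intro h
    rw [Btw, d_self, add_eq_zero] at h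
    exact (q.d_eq_zero_iff x y).1 h.1
  · rintro rfl
    exact btw_left _ _

lemma Btw.left_ne_top {x y z : X} (h : q.Btw x y z) (hz : q.d x z ≠ ∞) : q.d x y ≠ ∞ := by
  rw [← h] at hz
  exact (ENNReal.add_ne_top.1 hz).1

lemma Btw.right_ne_top {x y z : X} (h : q.Btw x y z) (hz : q.d x z ≠ ∞) : q.d y z ≠ ∞ := by
  rw [← h] at hz
  exact (ENNReal.add_ne_top.1 hz).2

lemma Btw.ne_top {x y z : X} (h : q.Btw x y z) (hxy : q.d x y ≠ ∞) (hyz : q.d y z ≠ ∞) :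
    q.d x z ≠ ∞ := by
  rw [← h]
  exact ENNReal.add_ne_top.2 ⟨hxy, hyz⟩

lemma Btw.trans_left {a x y b : X} (h₁ : q.Btw a x y) (h₂ : q.Btw a y b) : q.Btw a x b := by
  refine le_antisymm ?_ (q.triangle _ _ _)
  calc q.d a x + q.d x b ≤ q.d a x + (q.d x y + q.d y b) := by gcongr; exact q.triangle _ _ _
    _ = q.d a b := by rw [← add_assoc, h₁, h₂]

lemma Btw.trans_right {a x y b : X} (h₁ : q.Btw a x b) (h₂ : q.Btw x y b) : q.Btw a y b := by
  refine le_antisymm ?_ (q.triangle _ _ _)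
  calc q.d a y + q.d y b ≤ (q.d a x + q.d x y) + q.d y b := by gcongr; exact q.triangle _ _ _
    _ = q.d a b := by rw [add_assoc, h₂, h₁]

lemma Btw.drop_left {a x y b : X} (h₁ : q.Btw a x y) (h₂ : q.Btw a y b) (hx : q.d a x ≠ ∞) :
    q.Btw x y b := by
  refine le_antisymm ?_ (q.triangle _ _ _)
  rw [← ENNReal.add_le_add_iff_left hx, ← add_assoc, h₁, h₂]
  exact q.triangle _ _ _

lemma Btw.drop_right {a x y b : X} (h₁ : q.Btw a x b) (h₂ : q.Btw x y b) (hy : q.d y b ≠ ∞) :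
    q.Btw a x y := by
  refine le_antisymm ?_ (q.triangle _ _ _)
  rw [← ENNReal.add_le_add_iff_right hy, add_assoc, h₂, h₁]
  exact q.triangle _ _ _

lemma Btw.antisymm {a x y : X} (h₁ : q.Btw a x y) (h₂ : q.Btw a y x) (hx : q.d a x ≠ ∞) :
    x = y :=
  btw_self_iff.1 (h₁.drop_left h₂ hx)

end Betweenness

/-- No tuple is a 4-cut, in the form in which it is used: geodesic triples overlapping in
a nontrivial step glue. -/
def Glues : Prop :=
  ∀ ⦃w x y z : X⦄, q.d w x ≠ ∞ → q.d x y ≠ ∞ → q.d y z ≠ ∞ →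
    q.Btw w x y → q.Btw x y z → x ≠ y → q.Btw w x z

lemma glues_iff : q.Glues ↔ ¬ ∃ x₀ x₁ x₂ x₃ : X, q.FourCut x₀ x₁ x₂ x₃ := by
  simp only [Glues, FourCut]
  push Not
  rfl

section Successor

/-- The first point after `x` on the way from `x` to `y` (and `y` itself if there is
no such point). -/
noncomputable def next (x y : X) : X :=
  if h : ∃ s, q.Btw x s y ∧ s ≠ x ∧ ∀ a, q.Btw x a y → a ≠ x → q.Btw x s a then h.choose else y

lemma btw_next (x y : X) : q.Btw x (q.next x y) y := by
  unfold next
  split_ifs with h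
  · exact h.choose_spec.1
  · exact btw_right _ _

variable [Fintype X]

lemma exists_first (hgeo : q.Geodetic) {x y : X} (hxy : x ≠ y) (hd : q.d x y ≠ ∞) :
    ∃ s, q.Btw x s y ∧ s ≠ x ∧ ∀ a, q.Btw x a y → a ≠ x → q.Btw x s a := by
  obtain ⟨s, hs, hmin⟩ := Set.exists_min_image {a | q.Btw x a y ∧ a ≠ x} (q.d x)
    (Set.toFinite _) ⟨y, btw_right x y, hxy.symm⟩
  refine ⟨s, hs.1, hs.2, fun a ha hax => ?_⟩
  rcases hgeo x y s a hd hs.1 ha with h | h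
  · exact h
  · have hle := hmin a ⟨ha, hax⟩
    rw [← h] at hle
    have hfin := ha.left_ne_top hd
    have : q.d a s = 0 := by
      have : q.d x a + q.d a s ≤ q.d x a + 0 := by simpa using hle
      simpa using (ENNReal.add_le_add_iff_left hfin).1 this
    rw [(q.d_eq_zero_iff a s).1 this]
    exact btw_right _ _

variable {q} (hgeo : q.Geodetic)

include hgeo

lemma next_ne {x y : X} (hxy : x ≠ y) (hd : q.d x y ≠ ∞) : q.next x y ≠ x := by
  have h := q.exists_first hgeo hxy hd
  rw [next, dif_pos h]
  exact h.choose_spec.2.1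

lemma btw_next_of_btw {x y a : X} (hxy : x ≠ y) (hd : q.d x y ≠ ∞) (ha : q.Btw x a y)
    (hax : a ≠ x) : q.Btw x (q.next x y) a := by
  have h := q.exists_first hgeo hxy hd
  rw [next, dif_pos h]
  exact h.choose_spec.2.2 a ha hax

lemma next_eq_of_btw {x y z : X} (hxy : x ≠ y) (hd : q.d x z ≠ ∞) (h : q.Btw x y z) :
    q.next x z = q.next x y := by
  have hxz : x ≠ z := by
    rintro rfl
    exact hxy (btw_self_iff.1 h)
  have hdy := h.left_ne_top hd
  have h₁ : q.Btw x (q.next x z) y := btw_next_of_btw hgeo hxz hd h hxy.symm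
  have h₂ : q.Btw x (q.next x y) (q.next x z) :=
    btw_next_of_btw hgeo hxy hdy h₁ (next_ne hgeo hxz hd)
  have h₃ : q.Btw x (q.next x z) (q.next x y) :=
    btw_next_of_btw hgeo hxz hd ((q.btw_next x y).trans_left h) (next_ne hgeo hxy hdy)
  exact h₃.antisymm h₂ (h₁.left_ne_top hdy)

lemma eq_or_eq_of_next_eq {x y a : X} (hxy : x ≠ y) (hd : q.d x y ≠ ∞) (hn : q.next x y = y)
    (ha : q.Btw x a y) : a = x ∨ a = y := by
  by_cases hax : a = x
  · exact Or.inl hax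
  · have := btw_next_of_btw hgeo hxy hd ha hax
    rw [hn] at this
    exact Or.inr (ha.antisymm this (ha.left_ne_top hd))

end Successor

/-- Formal sums of tuples of arbitrary size, tuples being lists. -/
abbrev Formal (X : Type) : Type := List X →₀ ℤ

/-- Prepending a point to every tuple. -/
noncomputable def consMap (x : X) : Formal X →ₗ[ℤ] Formal X :=
  Finsupp.lmapDomain ℤ ℤ (List.cons x)

@[simp] lemma consMap_single (x : X) (l : List X) (n : ℤ) :
    consMap x (single l n) = single (x :: l) n := by
  simp [consMap]

/-- The first face of a tuple. -/
noncomputable def headFace : List X → Formal X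
  | x :: y :: r => if x = y then single (y :: r) 1 else 0
  | _ => 0

/-- The alternating sum of all faces of a tuple but the first. -/
noncomputable def tailFaces : List X → Formal X
  | x :: y :: z :: r =>
      (if q.Btw x y z then -single (x :: z :: r) 1 else 0) - consMap x (tailFaces (y :: z :: r))
  | [x, y] => if x = y then -single [x] 1 else 0
  | _ => 0

/-- Linear extension of `headFace`. -/
noncomputable def headMap : Formal X →ₗ[ℤ] Formal X := linearCombination ℤ headFace

/-- Linear extension of `tailFaces`. -/
noncomputable def tailMap : Formal X →ₗ[ℤ] Formal X := linearCombination ℤ q.tailFaces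

@[simp] lemma headMap_single (l : List X) : headMap (single l 1) = headFace l := by
  simp [headMap]

@[simp] lemma tailMap_single (l : List X) : q.tailMap (single l 1) = q.tailFaces l := by
  simp [tailMap]

/-- The contraction of the degenerate part: repeat the first repeated point. -/
noncomputable def repeatFirst : List X → Formal X
  | x :: y :: r =>
      if x = y then single (x :: x :: x :: r) 1 else -consMap x (repeatFirst (y :: r))
  | _ => 0

/-- The contraction of the part of nondegenerate tuples that are not saturated or not
singular at all inner points. -/
noncomputable def insertNext : List X → Formal X
  | x :: y :: z :: r =>
      if q.next x y = y then
        if q.Btw x y z then 0 else -consMap x (insertNext (y :: z :: r))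
      else -single (x :: q.next x y :: y :: z :: r) 1
  | [x, y] => if q.next x y = y then 0 else -single [x, q.next x y, y] 1
  | _ => 0

/-- Linear extension of `repeatFirst`. -/
noncomputable def repeatMap : Formal X →ₗ[ℤ] Formal X := linearCombination ℤ repeatFirst

/-- Linear extension of `insertNext`. -/
noncomputable def insertMap : Formal X →ₗ[ℤ] Formal X := linearCombination ℤ q.insertNext

@[simp] lemma repeatMap_single (l : List X) : repeatMap (single l 1) = repeatFirst l := by
  simp [repeatMap]

@[simp] lemma insertMap_single (l : List X) : q.insertMap (single l 1) = q.insertNext l := by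
  simp [insertMap]

lemma tailFaces_mem_range (x : X) (r : List X) :
    ∃ c, q.tailFaces (x :: r) = consMap x c := by
  match r with
  | [] => exact ⟨0, by simp [tailFaces]⟩
  | [y] =>
    refine ⟨if x = y then -single [] 1 else 0, ?_⟩
    by_cases h : x = y <;> simp [tailFaces, h]
  | y :: z :: r =>
    refine ⟨(if q.Btw x y z then -single (z :: r) 1 else 0) - q.tailFaces (y :: z :: r), ?_⟩
    by_cases h : q.Btw x y z <;> simp [tailFaces, h]

lemma repeatFirst_mem_range (x : X) (r : List X) :
    ∃ c, repeatFirst (x :: r) = consMap x c := by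
  match r with
  | [] => exact ⟨0, by simp [repeatFirst]⟩
  | y :: r =>
    refine ⟨if x = y then single (x :: x :: r) 1 else - repeatFirst (y :: r), ?_⟩
    by_cases h : x = y <;> simp [repeatFirst, h]

lemma tailFaces_cons_self (x : X) (r : List X) :
    q.tailFaces (x :: x :: r) = -single (x :: r) 1 - consMap x (q.tailFaces (x :: r)) := by
  cases r with
  | nil => simp [tailFaces]
  | cons z r => simp [tailFaces, btw_left]

lemma tailMap_consMap_consMap (x y v : X) (c : Formal X) :
    q.tailMap (consMap x (consMap y (consMap v c))) =
      (if q.Btw x y v then -consMap x (consMap v c) else 0)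
        - consMap x (q.tailMap (consMap y (consMap v c))) := by
  induction c using Finsupp.induction_linear with
  | zero => simp
  | add f g hf hg => simp only [map_add, hf, hg]; split_ifs <;> abel
  | single l n =>
    have : (single l n : Formal X) = n • single l 1 := by simp
    rw [this]
    simp only [map_smul, consMap_single, tailMap_single, tailFaces]
    split_ifs <;> simp [smul_sub]

lemma headMap_consMap_consMap (x y : X) (c : Formal X) :
    headMap (consMap x (consMap y c)) = if x = y then consMap y c else 0 := by
  induction c using Finsupp.induction_linear with
  | zero => simp
  | add f g hf hg => simp only [map_add, hf, hg]; split_ifs <;> simp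
  | single l n =>
    have : (single l n : Formal X) = n • single l 1 := by simp
    rw [this]
    simp only [map_smul, consMap_single, headMap_single, headFace]
    split_ifs <;> simp

lemma repeatMap_consMap_consMap_self (x : X) (c : Formal X) :
    repeatMap (consMap x (consMap x c)) = consMap x (consMap x (consMap x c)) := by
  induction c using Finsupp.induction_linear with
  | zero => simp
  | add f g hf hg => simp only [map_add, hf, hg]
  | single l n =>
    have : (single l n : Formal X) = n • single l 1 := by simp
    rw [this]
    simp only [map_smul, consMap_single, repeatMap_single, repeatFirst]
    simp

lemma repeatMap_consMap_consMap {x y : X} (hxy : x ≠ y) (c : Formal X) :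
    repeatMap (consMap x (consMap y c)) = -consMap x (repeatMap (consMap y c)) := by
  induction c using Finsupp.induction_linear with
  | zero => simp
  | add f g hf hg => simp only [map_add, hf, hg]; abel
  | single l n =>
    have : (single l n : Formal X) = n • single l 1 := by simp
    rw [this]
    simp only [map_smul, consMap_single, repeatMap_single, repeatFirst]
    simp [hxy]

lemma insertMap_consMap_consMap {x y : X} (h : q.next x y ≠ y) (c : Formal X) :
    q.insertMap (consMap x (consMap y c)) = -consMap x (consMap (q.next x y) (consMap y c)) := by
  induction c using Finsupp.induction_linear with
  | zero => simp
  | add f g hf hg => simp only [map_add, hf, hg]; abel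
  | single l n =>
    have : (single l n : Formal X) = n • single l 1 := by simp
    rw [this]
    simp only [map_smul, consMap_single, insertMap_single]
    cases l <;> simp [insertNext, h]

lemma insertMap_consMap_consMap_consMap {x y v : X} (h : q.next x y = y) (c : Formal X) :
    q.insertMap (consMap x (consMap y (consMap v c))) =
      if q.Btw x y v then 0 else -consMap x (q.insertMap (consMap y (consMap v c))) := by
  induction c using Finsupp.induction_linear with
  | zero => simp
  | add f g hf hg => simp only [map_add, hf, hg]; split_ifs <;> simp; abel
  | single l n =>
    have : (single l n : Formal X) = n • single l 1 := by simp
    rw [this]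
    simp only [map_smul, consMap_single, insertMap_single, insertNext, h]
    split_ifs <;> simp

/-- Consecutive points are different. -/
abbrev NonDeg (l : List X) : Prop := l.IsChain (· ≠ ·)

lemma headFace_eq_zero {l : List X} (h : NonDeg l) : headFace l = 0 := by
  match l with
  | [] => rfl
  | [_] => rfl
  | x :: y :: r =>
    rw [NonDeg, List.isChain_cons_cons] at h
    simp [headFace, h.1]

lemma degenerate_homotopy {l : List X} (h : ¬ NonDeg l) :
    headMap (repeatFirst l) + q.tailMap (repeatFirst l)
      + repeatMap (headFace l) + repeatMap (q.tailFaces l) = single l 1 := by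
  match l with
  | [] => simp [NonDeg] at h
  | [_] => simp [NonDeg] at h
  | x :: y :: r =>
    by_cases hxy : x = y
    · subst hxy
      obtain ⟨c, hc⟩ := q.tailFaces_mem_range x r
      have h₁ : repeatMap (consMap x (q.tailFaces (x :: r)))
          = consMap x (consMap x (q.tailFaces (x :: r))) := by
        rw [hc, repeatMap_consMap_consMap_self]
      simp only [repeatFirst, headFace, if_true, headMap_single, tailMap_single,
        repeatMap_single, q.tailFaces_cons_self, map_sub, map_neg, consMap_single, h₁]
      abel
    · match r with
      | [] => simp [NonDeg, hxy] at h
      | z :: r =>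
        have h' : ¬ NonDeg (y :: z :: r) := by
          simpa [NonDeg, List.isChain_cons_cons, hxy] using h
        have ih := degenerate_homotopy h'
        obtain ⟨c, hc⟩ := q.tailFaces_mem_range y (z :: r)
        have h₁ : repeatMap (consMap x (q.tailFaces (y :: z :: r)))
            = -consMap x (repeatMap (q.tailFaces (y :: z :: r))) := by
          rw [hc, repeatMap_consMap_consMap hxy]
        by_cases hyz : y = z
        · subst hyz
          have e₁ : repeatFirst (x :: y :: y :: r) = -single (x :: y :: y :: y :: r) 1 := by
            simp [repeatFirst, hxy]
          have e₂ : q.tailFaces (x :: y :: y :: r)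
              = -single (x :: y :: r) 1 - consMap x (q.tailFaces (y :: y :: r)) := by
            simp [tailFaces, btw_right]
          have e₃ : q.tailFaces (x :: y :: y :: y :: r)
              = -single (x :: y :: y :: r) 1 - consMap x (q.tailFaces (y :: y :: y :: r)) := by
            rw [tailFaces, if_pos (btw_right x y)]
          have e₄ : repeatFirst (x :: y :: r) = -consMap x (repeatFirst (y :: r)) := by
            simp [repeatFirst, hxy]
          have e₅ := congrArg (consMap x) ih
          simp only [repeatFirst, headFace, if_true, headMap_single, tailMap_single,
            repeatMap_single, map_add, consMap_single] at e₅
          rw [e₁, e₂]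
          simp only [map_neg, map_sub, headMap_single, tailMap_single, repeatMap_single, e₃, e₄, h₁,
            headFace, if_neg hxy, map_zero]
          rw [← sub_eq_zero] at e₅ ⊢
          refine Eq.trans ?_ e₅
          abel
        · obtain ⟨b, hb⟩ := repeatFirst_mem_range z r
          have e₀ : repeatFirst (y :: z :: r) = -consMap y (repeatFirst (z :: r)) := by
            simp [repeatFirst, hyz]
          have e₁ : repeatFirst (x :: y :: z :: r)
              = consMap x (consMap y (repeatFirst (z :: r))) := by
            rw [repeatFirst, if_neg hxy, e₀]; simp
          have e₅ := congrArg (consMap x) ih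
          simp only [e₀, hb, map_neg, headMap_consMap_consMap, if_neg hyz, headFace, map_zero,
            map_add, consMap_single] at e₅
          simp only [e₁, hb, headMap_consMap_consMap, tailMap_consMap_consMap, if_neg hxy,
            headFace, map_zero]
          rw [tailFaces, map_sub, h₁]
          rw [← sub_eq_zero] at e₅ ⊢
          refine Eq.trans ?_ e₅
          by_cases hB : q.Btw x y z
          · have hxz : x ≠ z := by
              rintro rfl
              exact hxy (btw_self_iff.1 hB)
            have e₆ : repeatFirst (x :: z :: r) = -consMap x (consMap z b) := by
              rw [repeatFirst, if_neg hxz, hb]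
            simp only [if_pos hB, map_neg, neg_neg, repeatMap_single, e₆]
            abel
          · simp only [if_neg hB, map_zero]
            abel

/-- All gaps are saturated and all inner points are singular. -/
def Rigid : List X → Prop
  | x :: y :: z :: r => q.next x y = y ∧ ¬ q.Btw x y z ∧ Rigid (y :: z :: r)
  | [x, y] => q.next x y = y
  | _ => True

/-- Consecutive points are different and at finite distance. -/
abbrev Regular (l : List X) : Prop := l.IsChain fun x y => x ≠ y ∧ q.d x y ≠ ∞

lemma tailFaces_eq_add {x y : X} {r : List X} (hl : q.Regular (x :: y :: r)) :
    ∃ b v c, q.Btw x y v ∧ q.d y v ≠ ∞ ∧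
      q.tailFaces (x :: y :: r) = consMap x (consMap y b) + consMap x (consMap v c) := by
  obtain ⟨⟨hxy, -⟩, hl⟩ := List.isChain_cons_cons.1 hl
  match r with
  | [] => exact ⟨0, y, 0, btw_right _ _, by simp [d_self], by simp [tailFaces, hxy]⟩
  | z :: r =>
    obtain ⟨b, hb⟩ := q.tailFaces_mem_range y (z :: r)
    by_cases h : q.Btw x y z
    · exact ⟨-b, z, -single r 1, h, (List.isChain_cons_cons.1 hl).1.2,
        by simp [tailFaces, h, hb]; abel⟩
    · exact ⟨-b, y, 0, btw_right _ _, by simp [d_self], by simp [tailFaces, h, hb]⟩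

lemma insertNext_mem_range (x y : X) (r : List X) :
    ∃ v c, (v = y ∨ v = q.next x y) ∧ q.insertNext (x :: y :: r) = consMap x (consMap v c) := by
  match r with
  | [] =>
    by_cases h : q.next x y = y
    · exact ⟨y, 0, Or.inl rfl, by simp [insertNext, h]⟩
    · exact ⟨q.next x y, -single [y] 1, Or.inr rfl, by simp [insertNext, h]⟩
  | z :: r =>
    by_cases h : q.next x y = y
    · by_cases hb : q.Btw x y z
      · exact ⟨y, 0, Or.inl rfl, by simp [insertNext, h, hb]⟩
      · obtain ⟨v, c, -, hc⟩ := insertNext_mem_range y z r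
        exact ⟨y, -consMap v c, Or.inl rfl, by simp [insertNext, h, hb, hc]⟩
    · exact ⟨q.next x y, -single (y :: z :: r) 1, Or.inr rfl, by simp [insertNext, h]⟩

lemma insertNext_of_next_ne {x y : X} (h : q.next x y ≠ y) (r : List X) :
    q.insertNext (x :: y :: r) = -single (x :: q.next x y :: y :: r) 1 := by
  cases r <;> simp [insertNext, h]

section Homotopy

variable {q} [Fintype X] (hgeo : q.Geodetic)

include hgeo

lemma headMap_insertNext {l : List X} (h : q.Regular l) : headMap (q.insertNext l) = 0 := by
  match l with
  | [] => simp [insertNext]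
  | [_] => simp [insertNext]
  | x :: y :: r =>
    obtain ⟨⟨hxy, hd⟩, -⟩ := List.isChain_cons_cons.1 h
    obtain ⟨v, c, hv, hc⟩ := q.insertNext_mem_range x y r
    have : x ≠ v := by
      rcases hv with rfl | rfl
      · exact hxy
      · exact (next_ne hgeo hxy hd).symm
    rw [hc, headMap_consMap_consMap, if_neg this]

theorem nondegenerate_homotopy (hglue : q.Glues) {l : List X} (h : q.Regular l) :
    q.tailMap (q.insertNext l) + q.insertMap (q.tailFaces l)
      = single l 1 - if q.Rigid l then single l 1 else 0 := by
  match l with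
  | [] => simp [insertNext, tailFaces, Rigid]
  | [_] => simp [insertNext, tailFaces, Rigid]
  | [x, y] =>
    obtain ⟨⟨hxy, hd⟩, -⟩ := List.isChain_cons_cons.1 h
    by_cases hn : q.next x y = y <;>
      simp [insertNext, tailFaces, Rigid, hn, hxy, q.btw_next x y]
  | x :: y :: z :: r =>
    obtain ⟨⟨hxy, hdxy⟩, h'⟩ := List.isChain_cons_cons.1 h
    obtain ⟨⟨hyz, hdyz⟩, -⟩ := List.isChain_cons_cons.1 h'
    by_cases hn : q.next x y = y
    · by_cases hb : q.Btw x y z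
      · have hdxz := hb.ne_top hdxy hdyz
        have hn' : q.next x z = y := by rw [next_eq_of_btw hgeo hxy hdxz hb, hn]
        obtain ⟨b, v, c, hv, hdv, hc⟩ := q.tailFaces_eq_add h'
        have h₁ : q.insertMap (consMap x (consMap y (consMap v c))) = 0 := by
          rw [insertMap_consMap_consMap_consMap q hn, if_pos (hglue hdxy hdyz hdv hb hv hyz)]
        have h₂ : q.insertMap (consMap x (q.tailFaces (y :: z :: r))) = 0 := by
          rw [hc, map_add, map_add, insertMap_consMap_consMap_consMap q hn, if_pos hb, h₁,
            add_zero]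
        have h₃ : q.insertNext (x :: z :: r) = -single (x :: y :: z :: r) 1 := by
          rw [insertNext_of_next_ne q (by rw [hn']; exact hyz), hn']
        rw [insertNext, if_pos hn, if_pos hb, tailFaces, if_pos hb, map_sub, h₂, map_neg,
          insertMap_single, h₃]
        simp [Rigid, hb]
      · have ih := nondegenerate_homotopy hglue h'
        obtain ⟨b, v, c, hv, hdv, hc⟩ := q.tailFaces_eq_add h'
        obtain ⟨u, e, hu, he⟩ := q.insertNext_mem_range y z r
        have hu' : ¬ q.Btw x y u := by
          rcases hu with rfl | rfl
          · exact hb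
          · intro hxu
            exact hb ((hglue hdxy ((q.btw_next y z).left_ne_top hdyz)
              ((q.btw_next y z).right_ne_top hdyz) hxu (q.btw_next y z)
              (next_ne hgeo hyz hdyz).symm))
        have hv' : ¬ q.Btw x y v := fun hxv => hb (hxv.drop_right hv hdv)
        have h₁ : q.tailMap (consMap x (q.insertNext (y :: z :: r)))
            = -consMap x (q.tailMap (q.insertNext (y :: z :: r))) := by
          rw [he, tailMap_consMap_consMap, if_neg hu', zero_sub]
        have h₂ : q.insertMap (consMap x (q.tailFaces (y :: z :: r)))
            = -consMap x (q.insertMap (q.tailFaces (y :: z :: r))) := by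
          rw [hc]
          simp only [map_add, insertMap_consMap_consMap_consMap q hn, if_neg hb, if_neg hv']
          abel
        rw [insertNext, if_pos hn, if_neg hb, tailFaces, if_neg hb, map_sub, map_neg, h₁, h₂]
        have e₅ := congrArg (consMap x) ih
        simp only [map_add, map_sub, consMap_single] at e₅
        simp only [map_zero, neg_neg, zero_sub, e₅, Rigid, hn, hb, true_and, not_false_eq_true]
        split_ifs <;> simp
    · have hs := q.btw_next x y
      have hds := hs.left_ne_top hdxy
      have hiff : q.Btw (q.next x y) y z ↔ q.Btw x y z :=
        ⟨fun hsyz => (hglue hds (hs.right_ne_top hdxy) hdyz hs hsyz hn).trans_right hsyz,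
          fun hb => hs.drop_left hb hds⟩
      obtain ⟨c, hc⟩ := q.tailFaces_mem_range y (z :: r)
      have h₁ : q.insertMap (consMap x (q.tailFaces (y :: z :: r)))
          = -consMap x (consMap (q.next x y) (q.tailFaces (y :: z :: r))) := by
        rw [hc, insertMap_consMap_consMap q hn]
      have h₂ : q.tailFaces (x :: q.next x y :: y :: z :: r) =
          -single (x :: y :: z :: r) 1 - consMap x
            ((if q.Btw (q.next x y) y z then -single (q.next x y :: z :: r) 1 else 0)
              - consMap (q.next x y) (q.tailFaces (y :: z :: r))) := by
        rw [tailFaces, if_pos hs, tailFaces]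
      rw [insertNext_of_next_ne q hn, map_neg, tailMap_single, h₂, tailFaces, map_sub q.insertMap, h₁]
      by_cases hb : q.Btw x y z
      · have hdxz := hb.ne_top hdxy hdyz
        have hn' := next_eq_of_btw hgeo hxy hdxz hb
        have hnz : q.next x z ≠ z := by
          rw [hn']
          intro hz
          rw [hz] at hs
          exact hyz (hb.antisymm hs hdxy)
        have h₃ : q.insertNext (x :: z :: r) = -single (x :: q.next x y :: z :: r) 1 := by
          rw [insertNext_of_next_ne q hnz, hn']
        simp [if_pos (hiff.2 hb), if_pos hb, h₃, Rigid, hn]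
        abel
      · simp [mt hiff.1 hb, hb, Rigid, hn]
        try abel

end Homotopy

section Supports

lemma map_mem_of_mem_supported {M : Type*} [AddCommGroup M] {s : Set (List X)}
    {S : Submodule ℤ M} (f : Formal X →ₗ[ℤ] M) (h : ∀ l ∈ s, f (single l 1) ∈ S)
    {c : Formal X} (hc : c ∈ supported ℤ ℤ s) : f c ∈ S := by
  rw [supported_eq_span_single] at hc
  refine (Submodule.span_le (p := S.comap f)).2 ?_ hc
  rintro _ ⟨l, hl, rfl⟩
  exact h l hl

lemma consMap_mem_supported {s t : Set (List X)} {x : X} (h : ∀ l ∈ s, x :: l ∈ t)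
    {c : Formal X} (hc : c ∈ supported ℤ ℤ s) : consMap x c ∈ supported ℤ ℤ t := by
  refine map_mem_of_mem_supported _ (fun l hl => ?_) hc
  rw [consMap_single]
  exact single_mem_supported ℤ 1 (h l hl)

lemma consMap_mem_supported_cons (x : X) (c : Formal X) :
    consMap x c ∈ supported ℤ ℤ {l | ∃ r, l = x :: r} :=
  consMap_mem_supported (s := Set.univ) (t := {l | ∃ r, l = x :: r})
    (fun l _ => ⟨l, rfl⟩) (by simp)

lemma tailFaces_mem_nonDeg {x : X} {r : List X} (h : NonDeg (x :: r)) :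
    q.tailFaces (x :: r) ∈ supported ℤ ℤ {l | NonDeg l ∧ l.head? = some x} := by
  match r with
  | [] => simp [tailFaces]
  | [y] =>
    have := (List.isChain_cons_cons.1 h).1
    simp [tailFaces, this]
  | y :: z :: r =>
    obtain ⟨hxy, h'⟩ := List.isChain_cons_cons.1 h
    rw [tailFaces]
    refine Submodule.sub_mem _ ?_ (consMap_mem_supported ?_ (tailFaces_mem_nonDeg h'))
    · split_ifs with hb
      · refine Submodule.neg_mem _ (single_mem_supported ℤ 1 ⟨?_, rfl⟩)
        refine List.isChain_cons_cons.2 ⟨?_, (List.isChain_cons_cons.1 h').2⟩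
        rintro rfl
        exact hxy (btw_self_iff.1 hb)
      · exact Submodule.zero_mem _
    · rintro l ⟨hl, hy⟩
      refine ⟨?_, rfl⟩
      cases l with
      | nil => simp at hy
      | cons a l =>
        obtain rfl : a = y := by simpa using hy
        exact List.isChain_cons_cons.2 ⟨hxy, hl⟩

lemma not_nonDeg_cons {x : X} {l : List X} (h : ¬ NonDeg l) : ¬ NonDeg (x :: l) :=
  fun h' => h h'.tail

lemma faces_mem_not_nonDeg {l : List X} (h : ¬ NonDeg l) :
    headFace l + q.tailFaces l ∈ supported ℤ ℤ {l | ¬ NonDeg l} := by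
  have twice (x : X) (r : List X) :
      consMap x (q.tailFaces (x :: r)) ∈ supported ℤ ℤ {l | ¬ NonDeg l} := by
    obtain ⟨c, hc⟩ := q.tailFaces_mem_range x r
    rw [hc]
    refine consMap_mem_supported ?_ (consMap_mem_supported_cons x c)
    rintro _ ⟨r, rfl⟩
    simp [NonDeg]
  match l with
  | [] => simp [NonDeg] at h
  | [_] => simp [NonDeg] at h
  | x :: y :: r =>
    by_cases hxy : x = y
    · subst hxy
      have e : headFace (x :: x :: r) + q.tailFaces (x :: x :: r)
          = -consMap x (q.tailFaces (x :: r)) := by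
        rw [tailFaces_cons_self, headFace, if_pos rfl]
        abel
      rw [e]
      exact Submodule.neg_mem _ (twice x r)
    · match r with
      | [] => simp [NonDeg, hxy] at h
      | z :: r =>
        have h' : ¬ NonDeg (y :: z :: r) := by
          simpa [NonDeg, List.isChain_cons_cons, hxy] using h
        rw [headFace, if_neg hxy, zero_add]
        by_cases hyz : y = z
        · subst hyz
          have e : q.tailFaces (x :: y :: y :: r)
              = consMap x (consMap y (q.tailFaces (y :: r))) := by
            simp [tailFaces, btw_right, tailFaces_cons_self]
          rw [e]
          exact consMap_mem_supported (fun _ => not_nonDeg_cons) (twice y r)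
        · have ih := faces_mem_not_nonDeg h'
          rw [headFace, if_neg hyz, zero_add] at ih
          rw [tailFaces]
          refine Submodule.sub_mem _ ?_ (consMap_mem_supported (fun _ => not_nonDeg_cons) ih)
          split_ifs
          · refine Submodule.neg_mem _ (single_mem_supported ℤ 1 (not_nonDeg_cons ?_))
            simpa [NonDeg, List.isChain_cons_cons, hyz] using h'
          · exact Submodule.zero_mem _

lemma tailFaces_eq_zero_of_rigid {l : List X} (h : NonDeg l) (hr : q.Rigid l) :
    q.tailFaces l = 0 := by
  match l with
  | [] => rfl
  | [_] => rfl
  | [x, y] => simp [tailFaces, (List.isChain_cons_cons.1 h).1]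
  | x :: y :: z :: r =>
    rw [tailFaces, tailFaces_eq_zero_of_rigid (List.isChain_cons_cons.1 h).2 hr.2.2,
      if_neg hr.2.1]
    simp

/-- The length of a tuple given as a list. -/
noncomputable def listLen : List X → ℝ≥0∞
  | x :: y :: r => q.d x y + listLen (y :: r)
  | _ => 0

lemma regular_of_nonDeg {l : List X} (h : NonDeg l) (hl : q.listLen l ≠ ∞) : q.Regular l := by
  match l with
  | [] => simp [Regular]
  | [_] => simp [Regular]
  | x :: y :: r =>
    rw [listLen, ENNReal.add_ne_top] at hl
    obtain ⟨hxy, h'⟩ := List.isChain_cons_cons.1 h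
    exact List.isChain_cons_cons.2 ⟨⟨hxy, hl.1⟩, regular_of_nonDeg h' hl.2⟩

/-- The tuples with one point more than `l`, but with the same first point and length. -/
def oneLonger (l : List X) : Set (List X) :=
  {l' | l'.head? = l.head? ∧ l'.length = l.length + 1 ∧ q.listLen l' = q.listLen l}

lemma cons_mem_oneLonger {x y : X} {r l : List X} (h : l ∈ q.oneLonger (y :: r)) :
    x :: l ∈ q.oneLonger (x :: y :: r) := by
  cases l with
  | nil => simp [oneLonger] at h
  | cons a l =>
    obtain ⟨h₁, h₂, h₃⟩ := h
    obtain rfl : a = y := by simpa using h₁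
    exact ⟨rfl, by simpa using h₂, by rw [listLen, h₃, listLen]⟩

lemma repeatFirst_mem_oneLonger (l : List X) :
    repeatFirst l ∈ supported ℤ ℤ (q.oneLonger l) := by
  match l with
  | [] => simp [repeatFirst]
  | [_] => simp [repeatFirst]
  | x :: y :: r =>
    rw [repeatFirst]
    split_ifs with h
    · subst h
      exact single_mem_supported ℤ 1 ⟨rfl, rfl, by simp [listLen, d_self]⟩
    · exact Submodule.neg_mem _ (consMap_mem_supported (fun _ => q.cons_mem_oneLonger)
        (repeatFirst_mem_oneLonger (y :: r)))

lemma insertNext_mem_oneLonger (l : List X) :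
    q.insertNext l ∈ supported ℤ ℤ (q.oneLonger l) := by
  match l with
  | [] => simp [insertNext]
  | [_] => simp [insertNext]
  | x :: y :: r =>
    by_cases hn : q.next x y = y
    · match r with
      | [] => simp [insertNext, hn]
      | z :: r =>
        by_cases hb : q.Btw x y z
        · simp [insertNext, hn, hb]
        · rw [insertNext, if_pos hn, if_neg hb]
          exact Submodule.neg_mem _ (consMap_mem_supported (fun _ => q.cons_mem_oneLonger)
            (insertNext_mem_oneLonger (y :: z :: r)))
    · rw [insertNext_of_next_ne q hn]
      refine Submodule.neg_mem _ (single_mem_supported ℤ 1 ⟨rfl, rfl, ?_⟩)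
      rw [listLen, listLen, listLen, ← add_assoc, q.btw_next x y]

end Supports

/-- The tuples of `n + 1` points and length `ℓ`. -/
def layer (n : ℕ) (ℓ : ℝ≥0∞) : Set (List X) := {l | l.length = n + 1 ∧ q.listLen l = ℓ}

lemma oneLonger_subset {n : ℕ} {ℓ : ℝ≥0∞} {l : List X} (h : l ∈ q.layer n ℓ) :
    q.oneLonger l ⊆ q.layer (n + 1) ℓ :=
  fun _ hl' => ⟨by rw [hl'.2.1, h.1], by rw [hl'.2.2, h.2]⟩

/-- On cycles, being a sum of rigid tuples is no restriction. -/
theorem exists_rigid_of_cycle [Fintype X] (hgeo : q.Geodetic) (hglue : q.Glues) {n : ℕ} {ℓ : ℝ≥0∞}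
    (hℓ : ℓ ≠ ∞) {c : Formal X} (hc : c ∈ supported ℤ ℤ (q.layer n ℓ))
    (hcycle : headMap c + q.tailMap c = 0) :
    ∃ b ∈ supported ℤ ℤ (q.layer (n + 1) ℓ),
      c - (headMap b + q.tailMap b) ∈
        supported ℤ ℤ {l | l ∈ q.layer n ℓ ∧ q.Regular l ∧ q.Rigid l} ∧
      headMap (c - (headMap b + q.tailMap b)) + q.tailMap (c - (headMap b + q.tailMap b)) = 0 := by
  set u := c.filter NonDeg with hu
  set v := c.filter (fun l => ¬ NonDeg l) with hv
  have huv : u + v = c := Finsupp.filter_add_filter_not c NonDeg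
  have hu_mem : u ∈ supported ℤ ℤ {l | l ∈ q.layer n ℓ ∧ NonDeg l} := by
    intro l hl
    simp only [hu, Finsupp.support_filter, Finset.coe_filter] at hl
    exact ⟨hc hl.1, hl.2⟩
  have hv_mem : v ∈ supported ℤ ℤ {l | l ∈ q.layer n ℓ ∧ ¬ NonDeg l} := by
    intro l hl
    simp only [hv, Finsupp.support_filter, Finset.coe_filter] at hl
    exact ⟨hc hl.1, hl.2⟩
  have hfaces : headMap u + q.tailMap u = 0 ∧ headMap v + q.tailMap v = 0 := by
    have h₁ : (headMap + q.tailMap : Formal X →ₗ[ℤ] Formal X) u ∈ supported ℤ ℤ {l | NonDeg l} := by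
      refine map_mem_of_mem_supported _ (fun l hl => ?_) hu_mem
      rw [LinearMap.add_apply, headMap_single, tailMap_single, headFace_eq_zero hl.2, zero_add]
      cases l with
      | nil => simp [tailFaces]
      | cons x r => exact supported_mono (fun _ h => h.1) (q.tailFaces_mem_nonDeg hl.2)
    have h₂ : (headMap + q.tailMap : Formal X →ₗ[ℤ] Formal X) v ∈ supported ℤ ℤ {l | ¬ NonDeg l} := by
      refine map_mem_of_mem_supported _ (fun l hl => ?_) hv_mem
      rw [LinearMap.add_apply, headMap_single, tailMap_single]
      exact q.faces_mem_not_nonDeg hl.2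
    have h₃ : (headMap + q.tailMap : Formal X →ₗ[ℤ] Formal X) u = -(headMap + q.tailMap : Formal X →ₗ[ℤ] Formal X) v := by
      rw [eq_neg_iff_add_eq_zero, ← map_add, huv]
      exact hcycle
    have h₄ : (headMap + q.tailMap : Formal X →ₗ[ℤ] Formal X) v = 0 := by
      refine Submodule.disjoint_def.1 (disjoint_supported_supported (M := ℤ) (R := ℤ)
        (s := {l : List X | NonDeg l}) (t := {l | ¬ NonDeg l}) ?_) _ ?_ h₂
      · exact Set.disjoint_left.2 fun l h h' => h' h
      · rw [← neg_neg ((headMap + q.tailMap : Formal X →ₗ[ℤ] Formal X) v), ← h₃]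
        exact Submodule.neg_mem _ h₁
    rw [h₄, neg_zero] at h₃
    exact ⟨h₃, h₄⟩
  have hv_eq : headMap (repeatMap v) + q.tailMap (repeatMap v) = v := by
    have h₁ : (headMap ∘ₗ repeatMap + q.tailMap ∘ₗ repeatMap
        + repeatMap ∘ₗ headMap + repeatMap ∘ₗ q.tailMap - LinearMap.id : Formal X →ₗ[ℤ] Formal X) v ∈
          (⊥ : Submodule ℤ (Formal X)) := by
      refine map_mem_of_mem_supported _ (fun l hl => ?_) hv_mem
      simpa [sub_eq_zero] using q.degenerate_homotopy hl.2
    have h₂ : repeatMap (headMap v) + repeatMap (q.tailMap v) = 0 := by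
      rw [← map_add, hfaces.2, map_zero]
    simp only [Submodule.mem_bot, LinearMap.sub_apply, LinearMap.add_apply, LinearMap.comp_apply,
      LinearMap.id_apply, sub_eq_zero] at h₁
    rwa [add_assoc, h₂, add_zero] at h₁
  have hreg {l : List X} (hl : l ∈ q.layer n ℓ ∧ NonDeg l) : q.Regular l :=
    q.regular_of_nonDeg hl.2 (by rw [hl.1.2]; exact hℓ)
  have hhead : headMap (q.insertMap u) = 0 := by
    have : (headMap ∘ₗ q.insertMap) u ∈ (⊥ : Submodule ℤ (Formal X)) := by
      refine map_mem_of_mem_supported _ (fun l hl => ?_) hu_mem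
      simpa using headMap_insertNext hgeo (hreg hl)
    simpa using this
  have hhead' : headMap u = 0 := by
    have : headMap u ∈ (⊥ : Submodule ℤ (Formal X)) := by
      refine map_mem_of_mem_supported _ (fun l hl => ?_) hu_mem
      simpa using headFace_eq_zero hl.2
    simpa using this
  have htail : q.tailMap u = 0 := by simpa [hhead'] using hfaces.1
  have hdiff : c - (headMap (repeatMap v + q.insertMap u)
      + q.tailMap (repeatMap v + q.insertMap u)) = u - q.tailMap (q.insertMap u) := by
    rw [map_add, map_add, hhead, ← huv, eq_sub_of_add_eq hv_eq]
    abel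
  have hrigid : u - q.tailMap (q.insertMap u) ∈
      supported ℤ ℤ {l | l ∈ q.layer n ℓ ∧ q.Regular l ∧ q.Rigid l} := by
    have h₁ : (LinearMap.id - (q.tailMap ∘ₗ q.insertMap + q.insertMap ∘ₗ q.tailMap)
         : Formal X →ₗ[ℤ] Formal X) u ∈
        supported ℤ ℤ {l | l ∈ q.layer n ℓ ∧ q.Regular l ∧ q.Rigid l} := by
      refine map_mem_of_mem_supported _ (fun l hl => ?_) hu_mem
      simp only [LinearMap.sub_apply, LinearMap.add_apply, LinearMap.comp_apply,
        LinearMap.id_apply, insertMap_single, tailMap_single,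
        nondegenerate_homotopy hgeo hglue (hreg hl), sub_sub_cancel]
      split_ifs with hr
      · exact single_mem_supported ℤ 1 ⟨hl.1, hreg hl, hr⟩
      · exact Submodule.zero_mem _
    simpa [htail] using h₁
  refine ⟨repeatMap v + q.insertMap u, Submodule.add_mem _ ?_ ?_, ?_, ?_⟩
  · refine map_mem_of_mem_supported _ (fun l hl => ?_) hv_mem
    rw [repeatMap_single]
    exact supported_mono (q.oneLonger_subset hl.1) (q.repeatFirst_mem_oneLonger l)
  · refine map_mem_of_mem_supported _ (fun l hl => ?_) hu_mem
    rw [insertMap_single]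
    exact supported_mono (q.oneLonger_subset hl.1) (q.insertNext_mem_oneLonger l)
  · rw [hdiff]
    exact hrigid
  · rw [hdiff]
    have : (headMap + q.tailMap : Formal X →ₗ[ℤ] Formal X) (u - q.tailMap (q.insertMap u)) ∈
        (⊥ : Submodule ℤ (Formal X)) := by
      refine map_mem_of_mem_supported _ (fun l hl => ?_) hrigid
      have hnd : NonDeg l := hl.2.1.imp fun _ _ h => h.1
      simp [headFace_eq_zero hnd, q.tailFaces_eq_zero_of_rigid hnd hl.2.2]
    simpa using this

section Tuples

/-- Tuples indexed by `Fin (n + 1)` as lists. -/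
noncomputable def toFormal (n : ℕ) : MC X n →ₗ[ℤ] Formal X :=
  Finsupp.lmapDomain ℤ ℤ List.ofFn

@[simp] lemma toFormal_single {n : ℕ} (t : Fin (n + 1) → X) (m : ℤ) :
    toFormal n (single t m) = single (List.ofFn t) m := by
  simp [toFormal]

lemma toFormal_injective (n : ℕ) : Function.Injective (toFormal (X := X) n) :=
  Finsupp.mapDomain_injective List.ofFn_injective

lemma listLen_ofFn {n : ℕ} (t : Fin (n + 1) → X) : q.listLen (List.ofFn t) = q.len t := by
  induction n with
  | zero => simp [listLen, len]
  | succ n ih =>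
    have := ih (fun i => t i.succ)
    rw [List.ofFn_succ] at this
    rw [List.ofFn_succ, List.ofFn_succ, listLen, this, len, len, Fin.sum_univ_succ]
    rfl

lemma delCond_zero {n : ℕ} (t : Fin (n + 2) → X) : q.delCond t 0 ↔ t 0 = t 1 := by
  rw [eq_comm, ← btw_self_iff (q := q)]
  simp [delCond]

lemma sum_tail_eq_tailFaces {n : ℕ} (t : Fin (n + 2) → X) :
    (∑ i : Fin (n + 1), if q.delCond t i.succ then
      ((-1 : ℤ) ^ (i.succ : ℕ)) • single (List.ofFn (t ∘ i.succ.succAbove)) (1 : ℤ) else 0)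
      = q.tailFaces (List.ofFn t) := by
  induction n with
  | zero =>
    have h : q.delCond t 1 ↔ t 0 = t 1 := by
      rw [← btw_self_iff (q := q)]
      simp [delCond]
    simp [h, tailFaces]
  | succ n ih =>
    have ih' := ih (fun i => t i.succ)
    rw [Fin.sum_univ_succ]
    have h₀ : q.delCond t (Fin.succ 0) ↔ q.Btw (t 0) (t 1) (t 2) := by
      simp [delCond]
      rfl
    have h₁ (i : Fin (n + 1)) :
        q.delCond t i.succ.succ ↔ q.delCond (fun j => t j.succ) i.succ := by
      simp [delCond]
    have h₂ (i : Fin (n + 1)) : List.ofFn (t ∘ i.succ.succ.succAbove)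
        = t 0 :: List.ofFn ((fun j => t j.succ) ∘ i.succ.succAbove) := by
      rw [List.ofFn_succ]
      simp [Function.comp_def]
    have h₃ : List.ofFn (t ∘ (Fin.succ 0 : Fin (n + 3)).succAbove)
        = t 0 :: List.ofFn (fun i => t (Fin.succ (Fin.succ i))) := by
      rw [List.ofFn_succ]
      simp
    have h₄ : List.ofFn (fun j => t (Fin.succ j)) = t 1 :: t 2 :: List.ofFn (fun i : Fin n => t i.succ.succ.succ) := by
      rw [List.ofFn_succ, List.ofFn_succ]
      rfl
    have h₅ : List.ofFn t = t 0 :: List.ofFn (fun j => t j.succ) := List.ofFn_succ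
    rw [h₅, h₄, tailFaces, ← h₄, ← ih', map_sum, sub_eq_add_neg, ← Finset.sum_neg_distrib]
    congr 1
    · simp only [h₀, h₃]
      rw [List.ofFn_succ (f := fun i => t (Fin.succ (Fin.succ i)))]
      split_ifs
      · simp
      · simp
    · refine Finset.sum_congr rfl fun i _ => ?_
      simp only [h₁, h₂]
      split_ifs
      · simp [pow_succ]
      · simp

lemma toFormal_bdry {n : ℕ} (c : MC X (n + 1)) :
    toFormal n (q.bdry n c) = headMap (toFormal (n + 1) c) + q.tailMap (toFormal (n + 1) c) := by
  induction c using Finsupp.induction_linear with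
  | zero => simp
  | add f g hf hg => simp only [map_add, hf, hg]; abel
  | single t m =>
    have : (single t m : MC X (n + 1)) = m • single t 1 := by simp
    rw [this]
    simp only [map_smul, toFormal_single, headMap_single, tailMap_single, ← smul_add]
    congr 1
    rw [← sum_tail_eq_tailFaces, bdry, Finsupp.lift_apply, Finsupp.sum_single_index (by simp),
      one_smul, map_sum, Fin.sum_univ_succ]
    congr 1
    · have h : t (Fin.succ 0) = t 1 := rfl
      rw [List.ofFn_succ, List.ofFn_succ, headFace, h]
      simp only [delCond_zero]
      split_ifs
      · simp
      · simp
    · refine Finset.sum_congr rfl fun i _ => ?_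
      split_ifs <;> simp

lemma saturated_of_regular_of_rigid [Fintype X] (hgeo : q.Geodetic) {n : ℕ}
    (t : Fin (n + 1) → X) (h : q.Regular (List.ofFn t)) (hr : q.Rigid (List.ofFn t)) :
    q.Saturated t := by
  induction n with
  | zero => exact fun i => i.elim0
  | succ n ih =>
    have h' := h
    rw [List.ofFn_succ, List.ofFn_succ] at h'
    obtain ⟨⟨hne, hd⟩, -⟩ := List.isChain_cons_cons.1 h'
    have htail : q.Regular (List.ofFn fun i => t (Fin.succ i)) := by
      rw [List.ofFn_succ] at h
      exact h.tail
    have hrig : q.next (t 0) (t 1) = t 1 ∧ q.Rigid (List.ofFn fun i => t (Fin.succ i)) := by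
      cases n with
      | zero => simpa [Rigid] using hr
      | succ n =>
        rw [List.ofFn_succ, List.ofFn_succ, List.ofFn_succ] at hr
        rw [List.ofFn_succ, List.ofFn_succ]
        exact ⟨hr.1, hr.2.2⟩
    intro i
    induction i using Fin.cases with
    | zero => exact fun a ha => eq_or_eq_of_next_eq hgeo hne hd hrig.1 ha
    | succ i => exact ih _ htail hrig.2 i

lemma exists_toFormal_eq {n : ℕ} {s : Set (List X)} (hs : ∀ l ∈ s, l.length = n + 1)
    {c : Formal X} (hc : c ∈ supported ℤ ℤ s) :
    ∃ b ∈ Submodule.span ℤ {f : MC X n | ∃ t, List.ofFn t ∈ s ∧ f = single t 1},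
      toFormal n b = c := by
  have : (LinearMap.id : Formal X →ₗ[ℤ] Formal X) c ∈ Submodule.map (toFormal n)
      (Submodule.span ℤ {f : MC X n | ∃ t, List.ofFn t ∈ s ∧ f = single t 1}) := by
    refine map_mem_of_mem_supported (LinearMap.id : Formal X →ₗ[ℤ] Formal X) (fun l hl => ?_) hc
    have hlen := hs l hl
    have e : List.ofFn (fun i : Fin (n + 1) => l.get (i.cast hlen.symm)) = l :=
      List.ext_getElem (by rw [List.length_ofFn, hlen]) fun i _ _ => by
        rw [List.getElem_ofFn]; rfl
    exact ⟨_, Submodule.subset_span ⟨_, by rw [e]; exact hl, rfl⟩, by rw [toFormal_single, e]; rfl⟩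
  exact this

lemma toFormal_mem_layer {n : ℕ} {ℓ : ℝ≥0∞} {c : MC X n} (hc : c ∈ q.grMC n ℓ) :
    toFormal n c ∈ supported ℤ ℤ (q.layer n ℓ) := by
  refine (Submodule.span_le (p := (supported ℤ ℤ (q.layer n ℓ)).comap (toFormal n))).2 ?_ hc
  rintro _ ⟨t, ht, rfl⟩
  simp only [SetLike.mem_coe, Submodule.mem_comap, toFormal_single]
  exact single_mem_supported ℤ 1 ⟨by simp, by rw [q.listLen_ofFn, ht]⟩

lemma mem_grZ_iff {n : ℕ} {ℓ : ℝ≥0∞} {c : MC X n} :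
    c ∈ q.grZ n ℓ ↔ c ∈ q.grMC n ℓ ∧ headMap (toFormal n c) + q.tailMap (toFormal n c) = 0 := by
  cases n with
  | zero =>
    refine ⟨fun h => ⟨h, ?_⟩, fun h => h.1⟩
    have : (headMap + q.tailMap : Formal X →ₗ[ℤ] Formal X) (toFormal 0 c) ∈
        (⊥ : Submodule ℤ (Formal X)) := by
      refine map_mem_of_mem_supported _ (fun l hl => ?_) (q.toFormal_mem_layer h)
      obtain ⟨x, rfl⟩ := List.length_eq_one_iff.1 hl.1
      simp [headFace, tailFaces]
    simpa using this
  | succ n =>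
    rw [← toFormal_bdry, map_eq_zero_iff _ (toFormal_injective n)]
    rfl

theorem diagonal_of_glues [Fintype X] (hgeo : q.Geodetic) (hglue : q.Glues) : q.Diagonal := by
  intro n ℓ z
  obtain ⟨hz, hcycle⟩ := q.mem_grZ_iff.1 z.2
  obtain ⟨b, hb, hrigid, hrcycle⟩ := q.exists_rigid_of_cycle hgeo hglue ENNReal.coe_ne_top
    (q.toFormal_mem_layer hz) hcycle
  obtain ⟨b', hb', rfl⟩ := exists_toFormal_eq (fun l hl => hl.1) hb
  obtain ⟨c, hc, hce⟩ := exists_toFormal_eq (fun l hl => hl.1.1) hrigid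
  have hbmem : b' ∈ q.grMC (n + 1) ℓ := by
    refine Submodule.span_mono ?_ hb'
    rintro _ ⟨t, ht, rfl⟩
    exact ⟨t, by rw [← listLen_ofFn]; exact ht.2, rfl⟩
  have hcsat : c ∈ Submodule.span ℤ
      {f | ∃ t : Fin (n + 1) → X, q.len t = (ℓ : ℝ≥0∞) ∧ q.Saturated t ∧ f = single t 1} := by
    refine Submodule.span_mono ?_ hc
    rintro _ ⟨t, ht, rfl⟩
    exact ⟨t, by rw [← listLen_ofFn]; exact ht.1.2,
      q.saturated_of_regular_of_rigid hgeo t ht.2.1 ht.2.2, rfl⟩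
  have hcmem : c ∈ q.grMC n ℓ := by
    refine Submodule.span_mono ?_ hcsat
    rintro _ ⟨t, ht, -, rfl⟩
    exact ⟨t, ht, rfl⟩
  have hcz : (z : MC X n) - c = q.bdry n b' := by
    apply toFormal_injective n
    rw [map_sub, hce, toFormal_bdry]
    abel
  refine ⟨⟨c, q.mem_grZ_iff.2 ⟨hcmem, by rw [hce]; exact hrcycle⟩⟩, hcsat, ?_⟩
  rw [eq_comm, Submodule.Quotient.eq]
  exact ⟨b', hbmem, hcz.symm⟩

end Tuples

section FourCuts

variable {q}

lemma exists_shortest_fourCut [Fintype X] (h : ∃ x₀ x₁ x₂ x₃ : X, q.FourCut x₀ x₁ x₂ x₃) :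
    ∃ x₀ x₁ x₂ x₃, q.FourCut x₀ x₁ x₂ x₃ ∧ ∀ y₀ y₁ y₂ y₃, q.FourCut y₀ y₁ y₂ y₃ →
      q.d x₀ x₁ + q.d x₁ x₃ ≤ q.d y₀ y₁ + q.d y₁ y₃ := by
  obtain ⟨x₀, x₁, x₂, x₃, hx⟩ := h
  obtain ⟨⟨w, x, y, z⟩, hc, hmin⟩ := Set.exists_min_image
    {c : X × X × X × X | q.FourCut c.1 c.2.1 c.2.2.1 c.2.2.2}
    (fun c => q.d c.1 c.2.1 + q.d c.2.1 c.2.2.2) (Set.toFinite _) ⟨(x₀, x₁, x₂, x₃), hx⟩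
  exact ⟨w, x, y, z, hc, fun y₀ y₁ y₂ y₃ hy => hmin (y₀, y₁, y₂, y₃) hy⟩

lemma FourCut.left_ne {w x y z : X} (h : q.FourCut w x y z) : w ≠ x := by
  rintro rfl
  exact h.2.2.2.2.2.2 (btw_left _ _)

lemma FourCut.right_ne {w x y z : X} (h : q.FourCut w x y z) : y ≠ z := by
  rintro rfl
  exact h.2.2.2.2.2.2 h.2.2.2.1

/-- `y` is an inner vertex of a 4-cut from `a` to `b`, and the path through `y` has
length `ℓ`. -/
def InnerVertex (q : QuasiMetric X) (a b : X) (ℓ : ℝ≥0∞) (y : X) : Prop :=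
  q.d a y + q.d y b = ℓ ∧ ∃ z, q.FourCut a y z b ∨ q.FourCut a z y b

lemma InnerVertex.left_ne {a b y : X} {ℓ : ℝ≥0∞} (h : q.InnerVertex a b ℓ y) : a ≠ y := by
  obtain ⟨-, z, h | h⟩ := h
  · exact h.left_ne
  · rintro rfl
    exact h.left_ne (btw_self_iff.1 h.2.2.2.1)

lemma InnerVertex.right_ne {a b y : X} {ℓ : ℝ≥0∞} (h : q.InnerVertex a b ℓ y) : y ≠ b := by
  obtain ⟨-, z, h | h⟩ := h
  · rintro rfl
    exact h.2.2.2.2.2.1 (btw_self_iff.1 h.2.2.2.2.1)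
  · exact h.right_ne

lemma not_saturated_of_innerVertex {t : Fin 3 → X} {ℓ : ℝ≥0∞}
    (h : q.InnerVertex (t 0) (t 2) ℓ (t 1)) : ¬ q.Saturated t := by
  intro hs
  obtain ⟨-, z, h | h⟩ := h
  · rcases hs 1 z h.2.2.2.2.1 with e | e
    · exact h.2.2.2.2.2.1 e.symm
    · exact h.right_ne e
  · rcases hs 0 z h.2.2.2.1 with e | e
    · exact h.left_ne e.symm
    · exact h.2.2.2.2.2.1 e

/-- On the steps of a path `(a, y, z, b)` as long as the shortest 4-cuts, the two inner faces
of the path agree on being made of inner vertices of 4-cuts. -/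
lemma innerVertex_iff (hgeo : q.Geodetic) {a y z b : X} {ℓ : ℝ≥0∞} (hℓ : ℓ ≠ ∞)
    (hmin : ∀ y₀ y₁ y₂ y₃, q.FourCut y₀ y₁ y₂ y₃ → ℓ ≤ q.d y₀ y₁ + q.d y₁ y₃)
    (hlen : q.d a y + q.d y z + q.d z b = ℓ) (hay : a ≠ y) (hyz : y ≠ z) (hzb : z ≠ b) :
    (q.Btw a y z ∧ q.InnerVertex a b ℓ z) ↔ (q.Btw y z b ∧ q.InnerVertex a b ℓ y) := by
  have hfin : q.d a y + q.d y z ≠ ∞ ∧ q.d z b ≠ ∞ := ENNReal.add_ne_top.1 (hlen ▸ hℓ)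
  obtain ⟨fay, fyz⟩ := ENNReal.add_ne_top.1 hfin.1
  have fzb := hfin.2
  have hleft : ¬ ℓ ≤ q.d y z + q.d z b := by
    rw [not_le, ← hlen, add_assoc, add_comm (q.d a y)]
    exact ENNReal.lt_add_right (ENNReal.add_ne_top.2 ⟨fyz, fzb⟩)
      fun h => hay ((q.d_eq_zero_iff _ _).1 h)
  have hright : ¬ ℓ ≤ q.d a y + q.d y z := by
    rw [not_le, ← hlen]
    exact ENNReal.lt_add_right hfin.1 fun h => hzb ((q.d_eq_zero_iff _ _).1 h)
  constructor
  · rintro ⟨hayz, -, w, hc | hc⟩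
    · obtain ⟨faz, fzw, fwb, hazw, hzwb, hzw, hn⟩ := hc
      have hyzb : q.Btw y z b := by
        by_contra hcon
        exact hleft (hmin y z w b ⟨fyz, fzw, fwb, hayz.drop_left hazw fay, hzwb, hzw, hcon⟩)
      exact ⟨hyzb, by rw [← hlen, add_assoc, hyzb], z,
        Or.inl ⟨fay, fyz, fzb, hayz, hyzb, hyz, fun h => hn (h.trans_right hyzb)⟩⟩
    · obtain ⟨faw, fwz, -, hawz, hwzb, hwz, hn⟩ := hc
      have hyzb : q.Btw y z b := by
        rcases hgeo a z y w (hayz.ne_top fay fyz) hayz hawz with h | h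
        · have hywz : q.Btw y w z := h.drop_left hawz fay
          by_contra hcon
          refine hleft ?_
          rw [← hywz, add_assoc, hwzb]
          exact hmin y w z b ⟨hywz.left_ne_top fyz, fwz, fzb, hywz, hwzb, hwz,
            fun h => hcon (h.trans_right hwzb)⟩
        · exact (h.drop_left hayz faw).drop_left hwzb (h.right_ne_top fay)
      exact ⟨hyzb, by rw [← hlen, add_assoc, hyzb], z,
        Or.inl ⟨fay, fyz, fzb, hayz, hyzb, hyz,
          fun h => hn (hawz.trans_left (h.trans_right hyzb))⟩⟩
  · rintro ⟨hyzb, -, w, hc | hc⟩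
    · obtain ⟨-, fyw, fwb, hayw, hywb, hyw, hn⟩ := hc
      have hayz : q.Btw a y z := by
        rcases hgeo y b z w (hyzb.ne_top fyz fzb) hyzb hywb with h | h
        · exact hayw.drop_right h (h.right_ne_top fyw)
        · by_contra hcon
          exact hright (hmin a y w z ⟨fay, fyw, h.right_ne_top fyz, hayw, h, hyw, hcon⟩)
      exact ⟨hayz, by rw [← hlen, hayz], y,
        Or.inr ⟨fay, fyz, fzb, hayz, hyzb, hyz, hn⟩⟩
    · obtain ⟨faw, fwy, -, hawy, hwyb, hwy, hn⟩ := hc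
      have hwyz : q.Btw w y z := hwyb.drop_right hyzb fzb
      have hayz : q.Btw a y z := by
        by_contra hcon
        refine hright ?_
        rw [← hawy, add_assoc, hwyz]
        exact hmin a w y z ⟨faw, fwy, fyz, hawy, hwyz, hwy, fun h => hcon (h.trans_right hwyz)⟩
      exact ⟨hayz, by rw [← hlen, hayz], y,
        Or.inr ⟨fay, fyz, fzb, hayz, hyzb, hyz, fun h => hn (hawy.trans_left h)⟩⟩

/-- The cochain counting the tuples `(a, y, b)` whose middle entry is an inner vertex of
a 4-cut from `a` to `b`. -/
noncomputable def cutCochain (q : QuasiMetric X) (a b : X) (ℓ : ℝ≥0∞) : MC X 2 →ₗ[ℤ] ℤ :=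
  linearCombination ℤ fun t => if t 0 = a ∧ t 2 = b ∧ q.InnerVertex a b ℓ (t 1) then 1 else 0

lemma bdry_single {n : ℕ} (t : Fin (n + 2) → X) :
    q.bdry n (single t 1) = ∑ i : Fin (n + 2),
      if q.delCond t i then ((-1 : ℤ) ^ (i : ℕ)) • single (t ∘ i.succAbove) (1 : ℤ) else 0 := by
  rw [bdry, Finsupp.lift_apply, Finsupp.sum_single_index (by simp), one_smul]

lemma cutCochain_bdry_single (hgeo : q.Geodetic) {a b : X} {ℓ : ℝ≥0∞} (hℓ : ℓ ≠ ∞)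
    (hmin : ∀ y₀ y₁ y₂ y₃, q.FourCut y₀ y₁ y₂ y₃ → ℓ ≤ q.d y₀ y₁ + q.d y₁ y₃)
    (t : Fin 4 → X) (ht : q.len t = ℓ) : q.cutCochain a b ℓ (q.bdry 2 (single t 1)) = 0 := by
  have hlen : q.d (t 0) (t 1) + q.d (t 1) (t 2) + q.d (t 2) (t 3) = ℓ := by
    rw [← ht, len, Fin.sum_univ_three]
    rfl
  have h₀ := q.delCond_zero t
  have h₁ : q.delCond t 1 ↔ q.Btw (t 0) (t 1) (t 2) := by rfl
  have h₂ : q.delCond t 2 ↔ q.Btw (t 1) (t 2) (t 3) := by rfl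
  have h₃ : q.delCond t 3 ↔ t 2 = t 3 := btw_self_iff
  have hface (i : Fin 4) : q.cutCochain a b ℓ (single (t ∘ i.succAbove) 1) =
      if t (i.succAbove 0) = a ∧ t (i.succAbove 2) = b ∧
        q.InnerVertex a b ℓ (t (i.succAbove 1)) then 1 else 0 := by
    simp [cutCochain]
  have f₀ : q.cutCochain a b ℓ (single (t ∘ Fin.succAbove 0) 1) =
    if t 1 = a ∧ t 3 = b ∧ q.InnerVertex a b ℓ (t 2) then 1 else 0 := hface 0
  have f₁ : q.cutCochain a b ℓ (single (t ∘ Fin.succAbove 1) 1) =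
    if t 0 = a ∧ t 3 = b ∧ q.InnerVertex a b ℓ (t 2) then 1 else 0 := hface 1
  have f₂ : q.cutCochain a b ℓ (single (t ∘ Fin.succAbove 2) 1) =
    if t 0 = a ∧ t 3 = b ∧ q.InnerVertex a b ℓ (t 1) then 1 else 0 := hface 2
  have f₃ : q.cutCochain a b ℓ (single (t ∘ Fin.succAbove 3) 1) =
    if t 0 = a ∧ t 2 = b ∧ q.InnerVertex a b ℓ (t 1) then 1 else 0 := hface 3
  have p₀ : (-1 : ℤ) ^ ((0 : Fin 4) : ℕ) = 1 := rfl
  have p₁ : (-1 : ℤ) ^ ((1 : Fin 4) : ℕ) = -1 := rfl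
  have p₂ : (-1 : ℤ) ^ ((2 : Fin 4) : ℕ) = 1 := rfl
  have p₃ : (-1 : ℤ) ^ ((3 : Fin 4) : ℕ) = -1 := rfl
  rw [bdry_single, Fin.sum_univ_four]
  simp only [h₀, h₁, h₂, h₃, map_add, apply_ite (q.cutCochain a b ℓ), map_smul, map_zero,
    p₀, p₁, p₂, p₃, f₀, f₁, f₂, f₃]
  by_cases h01 : t 0 = t 1
  · by_cases ha : t 0 = a
    · subst ha
      have : ¬ q.InnerVertex (t 0) b ℓ (t 0) := fun h => h.left_ne rfl
      simp only [← h01, btw_left, this, and_false, if_true, if_false, smul_zero, ite_self]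
      split_ifs <;> simp
    · simp [ha, ← h01]
  by_cases h23 : t 2 = t 3
  · by_cases hb : t 3 = b
    · subst hb
      have : ¬ q.InnerVertex a (t 3) ℓ (t 3) := fun h => h.right_ne rfl
      simp only [h01, h23, btw_right, this, and_false, if_true, if_false, smul_zero, ite_self]
      split_ifs <;> simp
    · simp [hb, h23]
  by_cases h12 : t 1 = t 2
  · rw [← h12] at h23 ⊢
    simp only [h01, h23, btw_left, btw_right, if_true, if_false]
    split_ifs <;> simp
  by_cases ha : t 0 = a
  · by_cases hb : t 3 = b
    · subst ha hb
      have := innerVertex_iff hgeo hℓ hmin hlen h01 h12 h23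
      simp only [h01, h23, true_and, if_false, zero_add, add_zero]
      split_ifs <;> first | (simp; done) | tauto
    · simp [h01, h23, hb]
  · simp [h01, h23, ha]

lemma not_isNDiagonal_two_of_fourCut [Fintype X] (hgeo : q.Geodetic)
    (h : ∃ x₀ x₁ x₂ x₃ : X, q.FourCut x₀ x₁ x₂ x₃) : ¬ q.IsNDiagonal 2 := by
  intro hdiag
  obtain ⟨w, x, y, z, hc, hmin⟩ := exists_shortest_fourCut h
  obtain ⟨fwx, fxy, fyz, hwxy, hxyz, hxy, hn⟩ := id hc
  have fxz := hxyz.ne_top fxy fyz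
  have hxz : x ≠ z := by
    rintro rfl
    exact hn (btw_right _ _)
  obtain ⟨ℓ, hℓ⟩ : ∃ ℓ : ℝ≥0, (ℓ : ℝ≥0∞) = q.d w x + q.d x z :=
    ⟨_, ENNReal.coe_toNNReal (ENNReal.add_ne_top.2 ⟨fwx, fxz⟩)⟩
  rw [← hℓ] at hmin
  have hlen : q.len ![w, x, z] = ℓ := by
    rw [hℓ, len, Fin.sum_univ_two]
    rfl
  have hcycle : single ![w, x, z] 1 ∈ q.grZ 2 ℓ := by
    refine ⟨Submodule.subset_span ⟨_, hlen, rfl⟩, ?_⟩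
    have h₀ : ¬ q.delCond ![w, x, z] 0 := fun h => hc.left_ne ((q.delCond_zero _).1 h)
    have h₁ : ¬ q.delCond ![w, x, z] 1 := hn
    have h₂ : ¬ q.delCond ![w, x, z] 2 := fun h => hxz (btw_self_iff.1 h)
    rw [SetLike.mem_coe, LinearMap.mem_ker, bdry_single, Fin.sum_univ_three, if_neg h₀, if_neg h₁,
      if_neg h₂]
    simp
  obtain ⟨c, hsat, hcz⟩ := hdiag ℓ ⟨_, hcycle⟩
  rw [Submodule.Quotient.eq] at hcz
  have hbdry : q.grB 2 ℓ ≤ LinearMap.ker (q.cutCochain w z ℓ) := by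
    rw [grB, Submodule.map_le_iff_le_comap, grMC, Submodule.span_le]
    rintro _ ⟨t, ht, rfl⟩
    exact cutCochain_bdry_single hgeo ENNReal.coe_ne_top hmin t ht
  have hzero : Submodule.span ℤ {f | ∃ t : Fin 3 → X, q.len t = (ℓ : ℝ≥0∞) ∧ q.Saturated t ∧
      f = single t 1} ≤ LinearMap.ker (q.cutCochain w z ℓ) := by
    rw [Submodule.span_le]
    rintro _ ⟨t, -, ht, rfl⟩
    have : ¬ (t 0 = w ∧ t 2 = z ∧ q.InnerVertex w z ℓ (t 1)) := by
      rintro ⟨rfl, rfl, h⟩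
      exact not_saturated_of_innerVertex h ht
    simp [cutCochain, this]
  have hone : q.cutCochain w z ℓ (single ![w, x, z] 1) = 1 := by
    have : q.InnerVertex w z ℓ x := ⟨hℓ.symm, y, Or.inl hc⟩
    simp [cutCochain, this]
  have hdiff : q.cutCochain w z ℓ ((c : MC X 2) - single ![w, x, z] 1) = 0 := hbdry hcz
  have hc0 : q.cutCochain w z ℓ c = 0 := hzero hsat
  rw [map_sub, hc0, hone] at hdiff
  norm_num at hdiff

end FourCuts

end QuasiMetric

/-- For a finite geodetic quasi metric space `X` the following are
equivalent: (1) `X` is diagonal; (2) `X` is 2-diagonal; (3) there is no 4-cut in `X`. -/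
theorem diagonal_iff_two_diagonal_iff_no_four_cut
    {X : Type} [Fintype X] (q : QuasiMetric X) (hgeo : q.Geodetic) :
    (q.Diagonal ↔ q.IsNDiagonal 2) ∧
    (q.IsNDiagonal 2 ↔ ¬ ∃ x0 x1 x2 x3 : X, q.FourCut x0 x1 x2 x3) := by
  have hcut : q.IsNDiagonal 2 → ¬ ∃ x0 x1 x2 x3 : X, q.FourCut x0 x1 x2 x3 :=
    fun h hc => QuasiMetric.not_isNDiagonal_two_of_fourCut hgeo hc h
  have hdiag : (¬ ∃ x0 x1 x2 x3 : X, q.FourCut x0 x1 x2 x3) → q.Diagonal :=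
    fun h => q.diagonal_of_glues hgeo (q.glues_iff.2 h)
  exact ⟨⟨fun h => h 2, fun h => hdiag (hcut h)⟩, ⟨hcut, fun h => hdiag h 2⟩⟩
end

section
/- Let X be a quasi metric space, let (x, y, z, w) be a 4-cut in X, and let A = {a ∈ X : x ≤ y ≤ a and z ≤ a ≤ w}. Then for all a ∈ A and b ∈ X, if z ≤ b ≤ a then b ∈ A. -/
open scoped ENNReal

/-- **Statement 9.** Let `(x, y, z, w)` be a 4-cut in a quasi metric space `X` and
`A = {a : x ≤ y ≤ a ∧ z ≤ a ≤ w}`. If `a ∈ A` and `z ≤ b ≤ a`, then `b ∈ A`. -/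
theorem fourCut_interval_mem {X : Type} (q : QuasiMetric X) (x y z w : X)
    (h : q.FourCut x y z w) (a b : X)
    (ha : q.Btw x y a ∧ q.Btw z a w) (hb : q.Btw z b a) :
    q.Btw x y b ∧ q.Btw z b w := by
  obtain ⟨-, -, hzw, -, hyzw, -, -⟩ := h
  obtain ⟨hxya, hzaw⟩ := ha
  unfold QuasiMetric.Btw at *
  have haw : q.d a w ≠ ∞ := ne_top_of_le_ne_top hzw (hzaw ▸ le_add_self)
  have hza : q.d z a ≠ ∞ := ne_top_of_le_ne_top hzw (hzaw ▸ le_self_add)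
  have hba : q.d b a ≠ ∞ := ne_top_of_le_ne_top hza (hb ▸ le_add_self)
  refine ⟨le_antisymm ?_ (q.triangle _ _ _), le_antisymm ?_ (q.triangle _ _ _)⟩
  · have hyba : q.d y b + q.d b a ≤ q.d y a := by
      refine (ENNReal.add_le_add_iff_right haw).1 ?_
      calc q.d y b + q.d b a + q.d a w
          ≤ q.d y z + q.d z b + q.d b a + q.d a w := by
            gcongr
            exact q.triangle _ _ _
        _ = q.d y w := by rw [add_assoc (q.d y z), hb, add_assoc, hzaw, hyzw]
        _ ≤ q.d y a + q.d a w := q.triangle _ _ _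
    refine (ENNReal.add_le_add_iff_right hba).1 ?_
    calc q.d x y + q.d y b + q.d b a
        = q.d x y + (q.d y b + q.d b a) := add_assoc _ _ _
      _ ≤ q.d x y + q.d y a := by gcongr
      _ = q.d x a := hxya
      _ ≤ q.d x b + q.d b a := q.triangle _ _ _
  · calc q.d z b + q.d b w
        ≤ q.d z b + (q.d b a + q.d a w) := by
          gcongr
          exact q.triangle _ _ _
      _ = q.d z w := by rw [← add_assoc, hb, hzaw]
end

section
/- Let X be a finite geodetic quasi metric space. If there exists a 4-cut (x, y, z, w) in X, then there exist x', y' ∈ X such that (x', y', z, w) is a 4-cut and the pair (x', y') is saturated, i.e. x' ≤ a ≤ y' implies a = x' or a = y'. -/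
open scoped ENNReal

namespace QuasiMetric

variable {X : Type} {q : QuasiMetric X} {a x y z w : X}

theorem Btw.tail (hxay : q.Btw x a y) (hxyz : q.Btw x y z) (hxa : q.d x a ≠ ∞) :
    q.Btw a y z := by
  refine le_antisymm ((ENNReal.add_le_add_iff_left hxa).1 ?_) (q.triangle a y z)
  rw [← add_assoc, hxay, hxyz]
  exact q.triangle x a z

theorem Btw.extend (hxay : q.Btw x a y) (hxyz : q.Btw x y z) : q.Btw x a z := by
  refine le_antisymm ?_ (q.triangle x a z)
  calc q.d x a + q.d a z ≤ q.d x a + (q.d a y + q.d y z) := by gcongr; exact q.triangle a y z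
    _ = q.d x z := by rw [← add_assoc, hxay, hxyz]

theorem Btw.comp (hayw : q.Btw a y w) (hxaw : q.Btw x a w) (hxay : q.Btw x a y) :
    q.Btw x y w := by
  unfold Btw at *
  rw [← hxay, add_assoc, hayw, hxaw]

theorem Btw.right_of_left (hayz : q.Btw a y z) (hyzw : q.Btw y z w) (hayw : q.Btw a y w) :
    q.Btw a z w := by
  unfold Btw at *
  rw [← hayz, add_assoc, hyzw, hayw]

theorem d_pos (h : x ≠ y) : q.d x y ≠ 0 := fun h0 => h ((q.d_eq_zero_iff x y).1 h0)

/-- A point strictly between the first two points of a 4-cut yields a 4-cut with the same last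
two points whose first two points are closer together. -/
theorem FourCut.exists_lt (h : q.FourCut x y z w) (ha : q.Btw x a y) (hax : a ≠ x)
    (hay : a ≠ y) : ∃ x' y', q.FourCut x' y' z w ∧ q.d x' y' < q.d x y := by
  obtain ⟨hxy, hyz, hzw, hxyz, hyzw, hne, hnot⟩ := h
  have hfin : q.d x a + q.d a y ≠ ∞ := by rwa [ha]
  obtain ⟨hxa, hay'⟩ := ENNReal.add_ne_top.1 hfin
  have hayz := ha.tail hxyz hxa
  by_cases hayw : q.Btw a y w
  · refine ⟨x, a, ⟨hxa, ?_, hzw, ha.extend hxyz, hayz.right_of_left hyzw hayw, ?_,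
      fun hxaw => hnot (hayw.comp hxaw ha)⟩, ?_⟩
    · rw [← hayz]
      exact ENNReal.add_ne_top.2 ⟨hay', hyz⟩
    · rintro rfl
      have h0 := hayz
      rw [Btw, (q.d_eq_zero_iff a a).2 rfl, add_eq_zero] at h0
      exact d_pos hne h0.2
    · rw [← ha]
      exact ENNReal.lt_add_right hxa (d_pos hay)
  · refine ⟨a, y, ⟨hay', hyz, hzw, hayz, hyzw, hne, hayw⟩, ?_⟩
    rw [← ha, add_comm]
    exact ENNReal.lt_add_right hay' (d_pos hax.symm)

end QuasiMetric

/-- **Statement 11.** In a finite geodetic quasi metric space, if `(x, y, z, w)` is a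
4-cut then there are `x', y'` such that `(x', y', z, w)` is a 4-cut with `(x', y')`
saturated. -/
theorem exists_fourCut_saturated_pair {X : Type} [Fintype X]
    (q : QuasiMetric X) (hgeo : q.Geodetic) (x y z w : X) (h : q.FourCut x y z w) :
    ∃ x' y' : X, q.FourCut x' y' z w ∧
      ∀ a : X, q.Btw x' a y' → a = x' ∨ a = y' := by
  obtain ⟨⟨x', y'⟩, hmem, hmin⟩ := Set.exists_min_image {p : X × X | q.FourCut p.1 p.2 z w}
    (fun p => q.d p.1 p.2) (Set.toFinite _) ⟨(x, y), h⟩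
  refine ⟨x', y', hmem, fun a ha => ?_⟩
  by_contra! hne
  obtain ⟨x'', y'', hcut, hlt⟩ := QuasiMetric.FourCut.exists_lt hmem ha hne.1 hne.2
  exact absurd (hmin (x'', y'') hcut) (not_le.2 hlt)
end
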